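/- In E_n^!, for any finite list of pairs (i_1,j_1), …, (i_w,j_w) with 1 ≤ i_s < j_s ≤ n, the product of a monomial with its reverse equals the product of the squares of its factors: (y_{i_1,j_1} y_{i_2,j_2} ⋯ y_{i_w,j_w}) (y_{i_w,j_w} ⋯ y_{i_2,j_2} y_{i_1,j_1}) = y_{i_1,j_1}^2 y_{i_2,j_2}^2 ⋯ y_{i_w,j_w}^2. -/

import Mathlib

/- The quadratic dual Fomin–Kirillov algebra `E_n^!` over an algebraically
closed field `k` of characteristic zero, presented as a quotient of the free
algebra on generators `y_{i,j}` (for `1 ≤ i < j ≤ n`, realized here with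
`0`-based indexing by the subtype of pairs `(i,j) : Fin n × Fin n` with `i < j`),
with the convention `y_{j,i} = -y_{i,j}`. -/

noncomputable section

variable (k : Type) [Field k] [IsAlgClosed k] [CharZero k]

/-- Index set for the generators: pairs `(i,j)` with `i < j`. -/
abbrev FKIdx (n : ℕ) := {p : Fin n × Fin n // p.1 < p.2}

/-- The element `y_{i,j}` of the free algebra, with the convention
`y_{j,i} = -y_{i,j}` (and `y_{i,i} = 0`, which is never used). -/
def Ygen (n : ℕ) (i j : Fin n) : FreeAlgebra k (FKIdx n) :=
  if h : i < j then FreeAlgebra.ι k ⟨(i, j), h⟩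
  else if h' : j < i then - FreeAlgebra.ι k ⟨(j, i), h'⟩
  else 0

/-- The defining relations of `E_n^!`. -/
inductive FKRel (n : ℕ) : FreeAlgebra k (FKIdx n) → FreeAlgebra k (FKIdx n) → Prop
  | triple (i j l : Fin n) (hij : i ≠ j) (hjl : j ≠ l) (hil : i ≠ l) :
      FKRel n (Ygen k n i j * Ygen k n j l + Ygen k n j l * Ygen k n i l) 0
  | disj (i j s t : Fin n) (hij : i < j) (hst : s < t)
      (h1 : i ≠ s) (h2 : i ≠ t) (h3 : j ≠ s) (h4 : j ≠ t) :
      FKRel n (Ygen k n i j * Ygen k n s t + Ygen k n s t * Ygen k n i j) 0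

/-- The quadratic dual Fomin–Kirillov algebra `E_n^!`. -/
abbrev FKDual (n : ℕ) := RingQuot (FKRel k n)

/-- The generator `y_{i,j}` of `E_n^!`. -/
def yy (n : ℕ) (i j : Fin n) : FKDual k n :=
  RingQuot.mkAlgHom k (FKRel k n) (Ygen k n i j)

/-- Cancellation with an additively invertible middle term, valid in any semiring. -/
theorem eq_of_add_zero {R : Type*} [Semiring R] {x y z : R} (h1 : x + y = 0) (h2 : y + z = 0) :
    x = z := by
  calc x = x + (y + z) := by rw [h2, add_zero]
    _ = z := by rw [← add_assoc, h1, zero_add]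

theorem sq_eq_of_add_zero {R : Type*} [Semiring R] {x y : R} (h : x + y = 0) :
    x ^ 2 = y ^ 2 := by
  refine eq_of_add_zero (y := y * x) ?_ ?_
  · rw [pow_two, ← add_mul, h, zero_mul]
  · rw [pow_two, ← mul_add, h, mul_zero]

theorem commute_of_add_zero {R : Type*} [Semiring R] {u x y : R} (h : x + y = 0)
    (hc : Commute u x) : Commute u y := by
  show u * y = y * u
  refine eq_of_add_zero (y := u * x) ?_ ?_
  · rw [← mul_add, add_comm y, h, mul_zero]
  · rw [hc.eq, ← add_mul, h, zero_mul]

theorem sq_commute_of_anti {R : Type*} [Semiring R] {x y : R} (h : x * y + y * x = 0) :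
    Commute (x ^ 2) y := by
  show x ^ 2 * y = y * x ^ 2
  refine eq_of_add_zero (y := x * y * x) ?_ ?_
  · rw [pow_two, mul_assoc, mul_assoc, ← mul_add, h, mul_zero]
  · rw [pow_two, ← mul_assoc, ← add_mul, h, zero_mul]

theorem sq_commute_of_triple {R : Type*} [Semiring R] {a a_neg b b_neg c : R}
    (ha : a + a_neg = 0) (hb : b + b_neg = 0)
    (e1 : c * a + a * b_neg = 0) (e2 : b_neg * a_neg + a_neg * c = 0) : Commute (a ^ 2) b := by
  have f1 : a * b = c * a := by
    refine eq_of_add_zero (y := a * b_neg) ?_ (by rw [add_comm, e1])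
    rw [← mul_add, hb, mul_zero]
  have f2 : b_neg * a_neg = b * a := by
    refine eq_of_add_zero (y := b * a_neg) ?_ ?_
    · rw [← add_mul, add_comm, hb, zero_mul]
    · rw [← mul_add, add_comm, ha, mul_zero]
  have f3 : a * c = b * a := by
    rw [← f2]
    refine eq_of_add_zero (y := a_neg * c) ?_ (by rw [add_comm, e2])
    rw [← add_mul, ha, zero_mul]
  show a ^ 2 * b = b * a ^ 2
  rw [pow_two, mul_assoc, f1, ← mul_assoc, f3, mul_assoc]

theorem yy_swap (n : ℕ) (i j : Fin n) : yy k n i j + yy k n j i = 0 := by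
  unfold yy
  rw [← map_add, ← map_zero (RingQuot.mkAlgHom k (FKRel k n))]
  congr 1
  unfold Ygen
  rcases lt_trichotomy i j with h | h | h
  · rw [dif_pos h, dif_neg h.not_gt, dif_pos h]
    exact add_neg_cancel _
  · subst h; simp
  · rw [dif_neg h.not_gt, dif_pos h, dif_pos h]
    exact neg_add_cancel _

theorem yy_triple (n : ℕ) (i j l : Fin n) (hij : i ≠ j) (hjl : j ≠ l) (hil : i ≠ l) :
    yy k n i j * yy k n j l + yy k n j l * yy k n i l = 0 := by
  have h := RingQuot.mkAlgHom_rel k (FKRel.triple (k := k) i j l hij hjl hil)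
  simp only [map_add, map_mul, map_zero] at h
  exact h

theorem yy_disj (n : ℕ) (i j s t : Fin n) (hij : i < j) (hst : s < t)
    (h1 : i ≠ s) (h2 : i ≠ t) (h3 : j ≠ s) (h4 : j ≠ t) :
    yy k n i j * yy k n s t + yy k n s t * yy k n i j = 0 := by
  have h := RingQuot.mkAlgHom_rel k (FKRel.disj (k := k) i j s t hij hst h1 h2 h3 h4)
  simp only [map_add, map_mul, map_zero] at h
  exact h

/-- The square of `y_{i,j}` commutes with `y_{j,l}`. -/
theorem yy_sq_adj (n : ℕ) (i j l : Fin n) (hij : i ≠ j) (hjl : j ≠ l) (hil : i ≠ l) :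
    Commute (yy k n i j ^ 2) (yy k n j l) :=
  sq_commute_of_triple (yy_swap k n i j) (yy_swap k n j l)
    (yy_triple k n l i j hil.symm hij hjl.symm)
    (yy_triple k n l j i hjl.symm hij.symm hil.symm)

theorem yy_sq_swap (n : ℕ) (i j : Fin n) : yy k n j i ^ 2 = yy k n i j ^ 2 :=
  sq_eq_of_add_zero (yy_swap k n j i)

/-- The squares of the generators commute with all generators. -/
theorem yy_sq_comm (n : ℕ) (i j s t : Fin n) (hij : i < j) (hst : s < t) :
    Commute (yy k n i j ^ 2) (yy k n s t) := by
  by_cases h1 : i = s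
  · subst h1
    by_cases h4 : j = t
    · subst h4; exact (Commute.refl _).pow_left 2
    · rw [← yy_sq_swap]; exact yy_sq_adj k n j i t hij.ne' hst.ne h4
  by_cases h2 : i = t
  · subst h2
    rw [← yy_sq_swap]
    exact commute_of_add_zero (yy_swap k n i s)
      (yy_sq_adj k n j i s hij.ne' hst.ne' (hst.trans hij).ne')
  by_cases h3 : j = s
  · subst h3
    exact yy_sq_adj k n i j t hij.ne hst.ne h2
  by_cases h4 : j = t
  · subst h4
    exact commute_of_add_zero (yy_swap k n j s) (yy_sq_adj k n i j s hij.ne hst.ne' h1)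
  exact sq_commute_of_anti (yy_disj k n i j s t hij hst h1 h2 h3 h4)

/-- in `E_n^!`, the product of a monomial with its reverse equals
the product of the squares of its factors:
`(y_{i_1,j_1} ⋯ y_{i_w,j_w})(y_{i_w,j_w} ⋯ y_{i_1,j_1}) = y_{i_1,j_1}^2 ⋯ y_{i_w,j_w}^2`. -/
theorem FKDual_monomial_mul_reverse (n : ℕ) (hn : 2 ≤ n) (L : List (FKIdx n)) :
    (L.map fun p => yy k n p.1.1 p.1.2).prod *
      (L.reverse.map fun p => yy k n p.1.1 p.1.2).prod =
    (L.map fun p => (yy k n p.1.1 p.1.2) ^ 2).prod := by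
  clear hn
  induction L with
  | nil => simp
  | cons p L ih =>
    have hc : Commute (yy k n p.1.1 p.1.2) (L.map fun p => (yy k n p.1.1 p.1.2) ^ 2).prod := by
      apply Commute.list_prod_right
      intro x hx
      obtain ⟨q, -, rfl⟩ := List.mem_map.1 hx
      exact (yy_sq_comm k n q.1.1 q.1.2 p.1.1 p.1.2 q.2 p.2).symm
    simp only [List.reverse_cons, List.map_append, List.map_cons, List.map_nil,
      List.prod_append, List.prod_cons, List.prod_nil, mul_one]
    rw [mul_assoc, ← mul_assoc (List.prod _) (List.prod _), ih, ← hc.eq, ← mul_assoc, pow_two]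

end
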